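/- Let M, N, K be finite simple undirected graphs, each having at least one edge. Then d satisfies the triangle inequality: d(M,K) ≤ d(M,N) + d(N,K). -/

import Mathlib

open Finset
open scoped Classical

/-- The measure of a vertex map `f : V(G) → V(H)` as a solution to `(G,w)` of Max H-Col:
the total `w`-weight of the edges of `G` carried by `f` to edges of `H`. -/
noncomputable def mcMeasure {V W : Type} [Fintype V] (G : SimpleGraph V) (H : SimpleGraph W)
    (w : Sym2 V → ℚ) (f : V → W) : ℚ :=
  ∑ e ∈ Finset.univ.filter (fun e : Sym2 V => e ∈ G.edgeSet ∧ Sym2.map f e ∈ H.edgeSet), w e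

/-- `mc H (G,w)`: the maximum measure over all vertex maps `f : V(G) → V(H)`. -/
noncomputable def mc {V W : Type} [Fintype V] [Fintype W]
    (G : SimpleGraph V) (H : SimpleGraph W) (w : Sym2 V → ℚ) : ℝ :=
  ⨆ f : V → W, (mcMeasure G H w f : ℝ)

/-- A weight function on `G`: positive rational weights on the edges of `G`. -/
def IsWeight {V : Type} (G : SimpleGraph V) (w : Sym2 V → ℚ) : Prop :=
  ∀ e ∈ G.edgeSet, 0 < w e

/-- `s(M,N)`: infimum of `mc_M(G,w)/mc_N(G,w)` over all graphs `G` with at least one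
edge and all weight functions `w` on `G`. -/
noncomputable def sVal {V W : Type} [Fintype V] [Fintype W]
    (M : SimpleGraph V) (N : SimpleGraph W) : ℝ :=
  sInf { r : ℝ | ∃ (n : ℕ) (G : SimpleGraph (Fin n)) (w : Sym2 (Fin n) → ℚ),
    G.edgeSet.Nonempty ∧ IsWeight G w ∧ r = mc G M w / mc G N w }

/-- `d(M,N) = 1 - s(M,N)·s(N,M)`. -/
noncomputable def dVal {V W : Type} [Fintype V] [Fintype W]
    (M : SimpleGraph V) (N : SimpleGraph W) : ℝ :=
  1 - sVal M N * sVal N M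

lemma mc_pos {V W : Type} [Fintype V] [Fintype W] {G : SimpleGraph V} {H : SimpleGraph W}
    {w : Sym2 V → ℚ} (hG : G.edgeSet.Nonempty) (hH : H.edgeSet.Nonempty) (hw : IsWeight G w) :
    0 < mc G H w := by
  obtain ⟨e, he⟩ := hG
  obtain ⟨e', he'⟩ := hH
  induction e using Sym2.ind with | _ a b =>
  induction e' using Sym2.ind with | _ x y =>
  let f : V → W := fun v => if v = a then x else y
  have hba : b ≠ a := (G.ne_of_adj he).symm
  have hf : 0 < mcMeasure G H w f := by
    refine Finset.sum_pos (fun e h => hw e (Finset.mem_filter.1 h).2.1) ⟨s(a, b), ?_⟩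
    refine Finset.mem_filter.2 ⟨Finset.mem_univ _, he, ?_⟩
    simpa [f, hba] using he'
  have hle : (mcMeasure G H w f : ℝ) ≤ mc G H w :=
    le_ciSup (f := fun f : V → W => (mcMeasure G H w f : ℝ)) (Set.finite_range _).bddAbove f
  exact lt_of_lt_of_le (by exact_mod_cast hf) hle

lemma sVal_le {A B : Type} [Fintype A] [Fintype B] {M : SimpleGraph A} {N : SimpleGraph B}
    (hM : M.edgeSet.Nonempty) (hN : N.edgeSet.Nonempty) {n : ℕ} {G : SimpleGraph (Fin n)}
    {w : Sym2 (Fin n) → ℚ} (hG : G.edgeSet.Nonempty) (hw : IsWeight G w) :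
    sVal M N ≤ mc G M w / mc G N w := by
  refine csInf_le ⟨0, ?_⟩ ⟨n, G, w, hG, hw, rfl⟩
  rintro _ ⟨n, G, w, hG, hw, rfl⟩
  exact (div_pos (mc_pos hG hM hw) (mc_pos hG hN hw)).le

lemma top_edgeSet_nonempty : (⊤ : SimpleGraph (Fin 2)).edgeSet.Nonempty :=
  ⟨s(0, 1), by simp⟩

lemma le_sVal {A B : Type} [Fintype A] [Fintype B] {M : SimpleGraph A} {N : SimpleGraph B} {c : ℝ}
    (h : ∀ (n : ℕ) (G : SimpleGraph (Fin n)) (w : Sym2 (Fin n) → ℚ),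
      G.edgeSet.Nonempty → IsWeight G w → c ≤ mc G M w / mc G N w) :
    c ≤ sVal M N := by
  refine le_csInf ⟨_, 2, ⊤, fun _ => 1, top_edgeSet_nonempty, fun _ _ => one_pos, rfl⟩ ?_
  rintro _ ⟨n, G, w, hG, hw, rfl⟩
  exact h n G w hG hw

lemma sVal_nonneg {A B : Type} [Fintype A] [Fintype B] {M : SimpleGraph A} {N : SimpleGraph B}
    (hM : M.edgeSet.Nonempty) (hN : N.edgeSet.Nonempty) : 0 ≤ sVal M N :=
  le_sVal fun _ _ _ hG hw => (div_pos (mc_pos hG hM hw) (mc_pos hG hN hw)).le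

lemma sVal_mul_sVal_le {A B C : Type} [Fintype A] [Fintype B] [Fintype C]
    {M : SimpleGraph A} {N : SimpleGraph B} {K : SimpleGraph C}
    (hM : M.edgeSet.Nonempty) (hN : N.edgeSet.Nonempty) (hK : K.edgeSet.Nonempty) :
    sVal M N * sVal N K ≤ sVal M K := by
  refine le_sVal fun n G w hG hw => ?_
  rw [← div_mul_div_cancel₀ (mc_pos hG hN hw).ne']
  exact mul_le_mul (sVal_le hM hN hG hw) (sVal_le hN hK hG hw) (sVal_nonneg hN hK)
    (div_pos (mc_pos hG hM hw) (mc_pos hG hN hw)).le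

lemma sVal_mul_sVal_comm_le_one {A B : Type} [Fintype A] [Fintype B]
    {M : SimpleGraph A} {N : SimpleGraph B}
    (hM : M.edgeSet.Nonempty) (hN : N.edgeSet.Nonempty) : sVal M N * sVal N M ≤ 1 := by
  have hw : IsWeight (⊤ : SimpleGraph (Fin 2)) (fun _ => 1) := fun _ _ => one_pos
  have hG := top_edgeSet_nonempty
  calc sVal M N * sVal N M ≤ sVal M M := sVal_mul_sVal_le hM hN hM
    _ ≤ _ := sVal_le hM hM hG hw
    _ = 1 := div_self (mc_pos hG hM hw).ne'

/-- the triangle inequality `d(M,K) ≤ d(M,N) + d(N,K)`. -/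
theorem stmt4 {A B C : Type} [Fintype A] [Fintype B] [Fintype C]
    (M : SimpleGraph A) (N : SimpleGraph B) (K : SimpleGraph C)
    (hM : M.edgeSet.Nonempty) (hN : N.edgeSet.Nonempty) (hK : K.edgeSet.Nonempty) :
    dVal M K ≤ dVal M N + dVal N K := by
  have h : (sVal M N * sVal N K) * (sVal K N * sVal N M) ≤ sVal M K * sVal K M :=
    mul_le_mul (sVal_mul_sVal_le hM hN hK) (sVal_mul_sVal_le hK hN hM)
      (mul_nonneg (sVal_nonneg hK hN) (sVal_nonneg hN hM)) (sVal_nonneg hM hK)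
  have h' := mul_nonneg (sub_nonneg.2 (sVal_mul_sVal_comm_le_one hM hN))
    (sub_nonneg.2 (sVal_mul_sVal_comm_le_one hN hK))
  unfold dVal
  linarith
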